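/- arXiv:2303.14808 — 3 statements merged into one kernel-verified Lean document; each statement's English description precedes it below -/
import Mathlib

section
/- Let μ be a symmetric Borel probability measure on ℝ with ∫_ℝ |λ|^δ dμ(λ) < ∞ for some δ > 0, and let F be a continuous centered stationary Gaussian process with spectral measure μ. Then there exist ℓ₀ > 0 and c > 1 such that for all T ≥ 1 and all ℓ > ℓ₀, P( sup_{t ∈ [0,T]} |F_t| ≤ ℓ ) ≥ ( P( c·|F_0| ≤ ℓ ) )^T. -/
open MeasureTheory ProbabilityTheory Set ENNReal NNReal

/-- The covariance kernel of a spectral measure: `k(t) = ∫ cos (λ t) dμ(λ)`. -/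
noncomputable def covKernel (μ : Measure ℝ) (t : ℝ) : ℝ := ∫ l, Real.cos (l * t) ∂μ

/-- `F` is a continuous centered stationary Gaussian process on `(Ω, P)` with spectral
measure `μ`: sample paths are continuous and every finite linear combination
`∑ cᵢ F_{tᵢ}` is a centered real Gaussian with variance `∑ᵢⱼ cᵢ cⱼ k(tᵢ - tⱼ)`. -/
def IsSGP {Ω : Type*} [MeasurableSpace Ω] (P : Measure Ω) (μ : Measure ℝ)
    (F : ℝ → Ω → ℝ) : Prop :=
  (∀ ω, Continuous fun t => F t ω) ∧
  ∀ (n : ℕ) (t : Fin n → ℝ) (c : Fin n → ℝ),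
    P.map (fun ω => ∑ i, c i * F (t i) ω) =
      gaussianReal 0 (∑ i, ∑ j, c i * c j * covKernel μ (t i - t j)).toNNReal

/-- The zero count `N_F(T)` as an extended natural number. -/
noncomputable def zeroCount {Ω : Type*} (F : ℝ → Ω → ℝ) (T : ℝ) (ω : Ω) : ℕ∞ :=
  {t ∈ Set.Icc (0:ℝ) T | F t ω = 0}.encard

/-- The topological support of a Borel measure on ℝ. -/
def msupport (μ : Measure ℝ) : Set ℝ := {x : ℝ | ∀ U ∈ nhds x, 0 < μ U}

/-- The one-dimensional Brunn–Minkowski inequality for midpoints. -/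
lemma volume_add_volume_le_of_midpoint {A B C : Set ℝ} (hA : MeasurableSet A)
    (hB : MeasurableSet B) (hA0 : A.Nonempty) (hB0 : B.Nonempty)
    (hC : ∀ a ∈ A, ∀ b ∈ B, (a + b) / 2 ∈ C) :
    volume A + volume B ≤ 2 * volume C := by
  obtain ⟨a₀, ha₀⟩ := hA0
  obtain ⟨b₀, hb₀⟩ := hB0
  have compact_case : ∀ K₁ ⊆ A, IsCompact K₁ → ∀ K₂ ⊆ B, IsCompact K₂ →
      volume K₁ + volume K₂ ≤ 2 * volume C := by
    intro K₁' hK₁A hK₁' K₂' hK₂B hK₂'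
    set K₁ := insert a₀ K₁' with hK₁def
    set K₂ := insert b₀ K₂' with hK₂def
    have hK₁ : IsCompact K₁ := hK₁'.insert a₀
    have hK₂ : IsCompact K₂ := hK₂'.insert b₀
    have hK₁A : K₁ ⊆ A := insert_subset ha₀ hK₁A
    have hK₂B : K₂ ⊆ B := insert_subset hb₀ hK₂B
    have ha : sSup K₁ ∈ K₁ := hK₁.sSup_mem (insert_nonempty _ _)
    have hb : sInf K₂ ∈ K₂ := hK₂.sInf_mem (insert_nonempty _ _)
    set a := sSup K₁
    set b := sInf K₂
    have h₁ : volume ((· - b) ⁻¹' K₁) = volume K₁ := by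
      simp [sub_eq_add_neg]
    have h₂ : volume ((· - a) ⁻¹' K₂) = volume K₂ := by
      simp [sub_eq_add_neg]
    have hdisj : AEDisjoint volume ((· - b) ⁻¹' K₁) ((· - a) ⁻¹' K₂) := by
      refine measure_mono_null (t := {a + b}) ?_ (by simp)
      rintro x ⟨hx₁, hx₂⟩
      have h1 : x - b ≤ a := le_csSup hK₁.bddAbove hx₁
      have h2 : b ≤ x - a := csInf_le hK₂.bddBelow hx₂
      simp only [mem_singleton_iff]
      linarith
    have hsub : ((· - b) ⁻¹' K₁) ∪ ((· - a) ⁻¹' K₂) ⊆ (· * (2 : ℝ)⁻¹) ⁻¹' C := by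
      rintro x (hx | hx)
      · have := hC _ (hK₁A hx) _ (hK₂B hb)
        simpa [div_eq_mul_inv] using this
      · have := hC _ (hK₁A ha) _ (hK₂B hx)
        simpa [div_eq_mul_inv] using this
    have hm : MeasurableSet ((· - a) ⁻¹' K₂) :=
      hK₂.isClosed.measurableSet.preimage (by fun_prop)
    calc volume K₁' + volume K₂' ≤ volume K₁ + volume K₂ :=
          add_le_add (measure_mono (subset_insert _ _)) (measure_mono (subset_insert _ _))
      _ = volume (((· - b) ⁻¹' K₁) ∪ ((· - a) ⁻¹' K₂)) := by
          rw [measure_union₀ hm.nullMeasurableSet hdisj, h₁, h₂]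
      _ ≤ volume ((· * (2 : ℝ)⁻¹) ⁻¹' C) := measure_mono hsub
      _ = 2 * volume C := by
          rw [Real.volume_preimage_mul_right (by norm_num)]
          simp
  rw [hA.measure_eq_iSup_isCompact, hB.measure_eq_iSup_isCompact]
  simp_rw [iSup_and']
  refine ENNReal.biSup_add_biSup_le' (p := fun K => K ⊆ A ∧ IsCompact K)
    (q := fun K => K ⊆ B ∧ IsCompact K) ⟨∅, by simp⟩ ⟨∅, by simp⟩ ?_
  rintro K₁ ⟨h₁, h₁'⟩ K₂ ⟨h₂, h₂'⟩
  exact compact_case K₁ h₁ h₁' K₂ h₂ h₂'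

/-- A functional inequality of Prékopa–Leindler type for midpoints, with a gain measured by `q`. -/
def PrekopaLeindler {E : Type*} [MeasurableSpace E] [AddCommGroup E] [Module ℝ E]
    (ν : Measure E) (q : E → ℝ) : Prop :=
  ∀ f g h : E → ℝ≥0∞, Measurable f → Measurable g → Measurable h →
    (∀ x y, f x * g y ≤ h ((2⁻¹ : ℝ) • (x + y)) ^ 2 * .ofReal (Real.exp (q (x - y) / 4))) →
    (∫⁻ x, f x ∂ν) * (∫⁻ x, g x ∂ν) ≤ (∫⁻ x, h x ∂ν) ^ 2

lemma lintegral_add_lintegral_le_of_midpoint {f g h : ℝ → ℝ≥0∞} (hf : Measurable f)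
    (hg : Measurable g) (hh : Measurable h) (hf1 : ⨆ x, f x = 1) (hg1 : ⨆ x, g x = 1)
    (H : ∀ x y, f x * g y ≤ h ((2⁻¹ : ℝ) • (x + y)) ^ 2) :
    (∫⁻ x, f x) + (∫⁻ x, g x) ≤ 2 * ∫⁻ x, h x := by
  have hfle : ∀ x, f x ≤ 1 := fun x => hf1 ▸ le_iSup f x
  have hgle : ∀ x, g x ≤ 1 := fun x => hg1 ▸ le_iSup g x
  have layer : ∀ u : ℝ → ℝ≥0∞, Measurable u → (∀ x, u x ≤ 1) →
      ∫⁻ x, u x = ∫⁻ t in Ioi (0 : ℝ), volume {x | ENNReal.ofReal t < u x} := by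
    intro u hu hu1
    have hfin : ∀ x, u x ≠ ∞ := fun x => ne_top_of_le_ne_top one_ne_top (hu1 x)
    have := lintegral_eq_lintegral_meas_lt (volume : Measure ℝ) (f := fun x => (u x).toReal)
      (.of_forall fun x => ENNReal.toReal_nonneg) hu.ennreal_toReal.aemeasurable
    simp_rw [ENNReal.ofReal_toReal (hfin _)] at this
    rw [this]
    refine setLIntegral_congr_fun measurableSet_Ioi fun t ht => ?_
    simp_rw [ENNReal.ofReal_lt_iff_lt_toReal (le_of_lt (mem_Ioi.1 ht)) (hfin _)]
  have hmin : ∫⁻ x, min (h x) 1 ≤ ∫⁻ x, h x := lintegral_mono fun x => min_le_left _ _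
  refine le_trans ?_ (mul_le_mul_right hmin 2)
  rw [layer f hf hfle, layer g hg hgle,
    layer (fun x => min (h x) 1) (hh.min measurable_const) (fun x => min_le_right _ _)]
  refine (le_lintegral_add _ _).trans ?_
  rw [← lintegral_const_mul' _ _ (by simp)]
  refine setLIntegral_mono' measurableSet_Ioi fun t ht => ?_
  rcases lt_or_ge t 1 with ht1 | ht1
  · have ht1' : ENNReal.ofReal t < 1 := by simpa using ht1
    have hne : ∀ u : ℝ → ℝ≥0∞, ⨆ x, u x = 1 → {x | ENNReal.ofReal t < u x}.Nonempty := by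
      intro u hu
      rw [← hu, lt_iSup_iff] at ht1'
      exact ht1'
    refine volume_add_volume_le_of_midpoint (measurableSet_lt measurable_const hf)
      (measurableSet_lt measurable_const hg) (hne f hf1) (hne g hg1) ?_
    intro x hx y hy
    have h1 : ENNReal.ofReal t ^ 2 < h ((2⁻¹ : ℝ) • (x + y)) ^ 2 := by
      refine lt_of_lt_of_le ?_ (H x y)
      rw [sq]
      exact ENNReal.mul_lt_mul hx hy
    have h2 : ENNReal.ofReal t < h ((2⁻¹ : ℝ) • (x + y)) := lt_of_pow_lt_pow_left' 2 h1
    have h3 : (x + y) / 2 = (2⁻¹ : ℝ) • (x + y) := by simp [div_eq_inv_mul]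
    simp only [mem_ofPred_eq, lt_min_iff, h3]
    exact ⟨h2, ht1'⟩
  · have : ∀ u : ℝ → ℝ≥0∞, (∀ x, u x ≤ 1) → {x | ENNReal.ofReal t < u x} = ∅ := by
      intro u hu
      ext x
      simp only [mem_ofPred_eq, mem_empty_iff_false, iff_false, not_lt]
      exact (hu x).trans (by simpa using ht1)
    simp [this f hfle, this g hgle]

lemma ENNReal.four_mul_mul_le_add_sq (u v : ℝ≥0∞) : 4 * (u * v) ≤ (u + v) ^ 2 := by
  rcases eq_or_ne u ∞ with rfl | hu
  · simp
  rcases eq_or_ne v ∞ with rfl | hv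
  · simp
  lift u to ℝ≥0 using hu
  lift v to ℝ≥0 using hv
  norm_cast
  rw [← NNReal.coe_le_coe]
  push_cast
  nlinarith [sq_nonneg ((u : ℝ) - v)]

lemma prekopaLeindler_volume_of_iSup_ne_top {f g h : ℝ → ℝ≥0∞} (hf : Measurable f)
    (hg : Measurable g) (hh : Measurable h) (hfb : ⨆ x, f x ≠ ∞) (hgb : ⨆ x, g x ≠ ∞)
    (H : ∀ x y, f x * g y ≤ h ((2⁻¹ : ℝ) • (x + y)) ^ 2) :
    (∫⁻ x, f x) * (∫⁻ x, g x) ≤ (∫⁻ x, h x) ^ 2 := by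
  set A := ⨆ x, f x with hA
  set B := ⨆ x, g x with hB
  rcases eq_or_ne A 0 with hA0 | hA0
  · have : ∀ x, f x = 0 := by simpa [hA] using hA0
    simp [this]
  rcases eq_or_ne B 0 with hB0 | hB0
  · have : ∀ x, g x = 0 := by simpa [hB] using hB0
    simp [this]
  set D : ℝ≥0∞ := (A * B) ^ (2⁻¹ : ℝ) with hD
  have hAB0 : A * B ≠ 0 := mul_ne_zero hA0 hB0
  have hABt : A * B ≠ ∞ := ENNReal.mul_ne_top hfb hgb
  have hD2 : D ^ 2 = A * B := by
    rw [hD, ← ENNReal.rpow_natCast, ← ENNReal.rpow_mul]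
    simp
  have hinv : (D⁻¹) ^ 2 = A⁻¹ * B⁻¹ := by
    rw [← ENNReal.inv_pow, hD2, ENNReal.mul_inv (.inl hA0) (.inl hfb)]
  have key := lintegral_add_lintegral_le_of_midpoint (f := fun x => A⁻¹ * f x)
    (g := fun x => B⁻¹ * g x) (h := fun x => D⁻¹ * h x) (hf.const_mul _) (hg.const_mul _)
    (hh.const_mul _) (by rw [← ENNReal.mul_iSup, ← hA, ENNReal.inv_mul_cancel hA0 hfb])
    (by rw [← ENNReal.mul_iSup, ← hB, ENNReal.inv_mul_cancel hB0 hgb])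
    (fun x y => by
      rw [mul_pow, hinv, mul_mul_mul_comm]
      exact mul_le_mul_right (H x y) _)
  rw [lintegral_const_mul _ hf, lintegral_const_mul _ hg, lintegral_const_mul _ hh] at key
  have h4 := (ENNReal.four_mul_mul_le_add_sq _ _).trans (pow_le_pow_left' key 2)
  rw [mul_pow, mul_pow, hinv, mul_mul_mul_comm A⁻¹, show (2 : ℝ≥0∞) ^ 2 = 4 by norm_num,
    ← ENNReal.mul_inv (.inl hA0) (.inl hfb)] at h4
  rwa [ENNReal.mul_le_mul_iff_right (by simp) (by simp),
    ENNReal.mul_le_mul_iff_right (by simpa using hABt) (by simpa using hAB0)] at h4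

lemma lintegral_eq_iSup_lintegral_min {f : ℝ → ℝ≥0∞} (hf : Measurable f) :
    ∫⁻ x, f x = ⨆ n : ℕ, ∫⁻ x, min (f x) n := by
  rw [← lintegral_iSup (fun n => hf.min measurable_const)
    (fun m n hmn x => min_le_min_left _ (by exact_mod_cast hmn))]
  congr with x
  refine le_antisymm ?_ (iSup_le fun n => min_le_left _ _)
  refine le_of_forall_lt fun c hc => ?_
  obtain ⟨n, hn⟩ := ENNReal.exists_nat_gt hc.ne_top
  exact lt_iSup_iff.2 ⟨n, lt_min hc hn⟩

lemma prekopaLeindler_volume : PrekopaLeindler (volume : Measure ℝ) 0 := by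
  intro f g h hf hg hh H
  simp only [Pi.zero_apply, zero_div, Real.exp_zero, ENNReal.ofReal_one, mul_one] at H
  rw [lintegral_eq_iSup_lintegral_min hf, lintegral_eq_iSup_lintegral_min hg, ENNReal.iSup_mul]
  refine iSup_le fun m => ?_
  rw [ENNReal.mul_iSup]
  refine iSup_le fun n => ?_
  refine prekopaLeindler_volume_of_iSup_ne_top (hf.min measurable_const) (hg.min measurable_const)
    hh ?_ ?_ fun x y => (mul_le_mul' (min_le_left _ _) (min_le_left _ _)).trans (H x y)
  · exact ne_top_of_le_ne_top (natCast_ne_top m) (iSup_le fun x => min_le_right _ _)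
  · exact ne_top_of_le_ne_top (natCast_ne_top n) (iSup_le fun x => min_le_right _ _)

lemma prekopaLeindler_gaussianReal : PrekopaLeindler (gaussianReal 0 1) fun x => x ^ 2 := by
  intro f g h hf hg hh H
  have hv : (1 : ℝ≥0) ≠ 0 := one_ne_zero
  have hpdf : Measurable (gaussianPDF 0 1) := measurable_gaussianPDF 0 1
  rw [gaussianReal_of_var_ne_zero _ hv]
  rw [lintegral_withDensity_eq_lintegral_mul _ hpdf hf,
    lintegral_withDensity_eq_lintegral_mul _ hpdf hg,
    lintegral_withDensity_eq_lintegral_mul _ hpdf hh]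
  refine prekopaLeindler_volume _ _ _ (hpdf.mul hf) (hpdf.mul hg) (hpdf.mul hh) fun x y => ?_
  have hφ : gaussianPDF 0 1 x * gaussianPDF 0 1 y * ENNReal.ofReal (Real.exp ((x - y) ^ 2 / 4)) =
      gaussianPDF 0 1 ((2⁻¹ : ℝ) • (x + y)) ^ 2 := by
    simp only [gaussianPDF, gaussianPDFReal]
    rw [← ENNReal.ofReal_mul (by positivity), ← ENNReal.ofReal_mul (by positivity),
      ← ENNReal.ofReal_pow (by positivity)]
    congr 1
    rw [mul_pow, ← Real.exp_nat_mul, mul_mul_mul_comm, mul_assoc, ← Real.exp_add, ← Real.exp_add,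
      ← sq]
    congr 2
    simp
    ring
  simp only [Pi.mul_apply, Pi.zero_apply, zero_div, Real.exp_zero, ENNReal.ofReal_one, mul_one]
  calc gaussianPDF 0 1 x * f x * (gaussianPDF 0 1 y * g y)
      = gaussianPDF 0 1 x * gaussianPDF 0 1 y * (f x * g y) := by ring
    _ ≤ gaussianPDF 0 1 x * gaussianPDF 0 1 y * _ := mul_le_mul_right (H x y) _
    _ = (gaussianPDF 0 1 x * gaussianPDF 0 1 y * ENNReal.ofReal (Real.exp ((x - y) ^ 2 / 4))) *
        h ((2⁻¹ : ℝ) • (x + y)) ^ 2 := by ring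
    _ = _ := by rw [hφ, mul_pow]

section

variable {E F : Type*} [MeasurableSpace E] [AddCommGroup E] [Module ℝ E]
  [MeasurableSpace F] [AddCommGroup F] [Module ℝ F]

lemma PrekopaLeindler.map {ν : Measure E} {q : E → ℝ} (hν : PrekopaLeindler ν q) {p : F → ℝ}
    {φ : E → F} (hφ : Measurable φ)
    (hmid : ∀ x y, φ ((2⁻¹ : ℝ) • (x + y)) = (2⁻¹ : ℝ) • (φ x + φ y))
    (hp : ∀ x y, p (φ x - φ y) = q (x - y)) : PrekopaLeindler (ν.map φ) p := by
  intro f g h hf hg hh H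
  rw [lintegral_map hf hφ, lintegral_map hg hφ, lintegral_map hh hφ]
  refine hν _ _ _ (hf.comp hφ) (hg.comp hφ) (hh.comp hφ) fun x y => ?_
  rw [hmid, ← hp]
  exact H _ _

lemma PrekopaLeindler.prod {ν : Measure E} {q : E → ℝ} (hν : PrekopaLeindler ν q)
    {ρ : Measure F} {p : F → ℝ} (hρ : PrekopaLeindler ρ p) [SFinite ρ] :
    PrekopaLeindler (ν.prod ρ) fun x => q x.1 + p x.2 := by
  intro f g h hf hg hh H
  rw [lintegral_prod _ hf.aemeasurable, lintegral_prod _ hg.aemeasurable,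
    lintegral_prod _ hh.aemeasurable]
  refine hν _ _ _ hf.lintegral_prod_right' hg.lintegral_prod_right' hh.lintegral_prod_right'
    fun s t => ?_
  have hsq : ENNReal.ofReal (Real.exp (q (s - t) / 4)) =
      ENNReal.ofReal (Real.exp (q (s - t) / 8)) ^ 2 := by
    rw [← ENNReal.ofReal_pow (by positivity), ← Real.exp_nat_mul]
    congr 2
    push_cast
    ring
  rw [hsq, ← mul_pow, ← lintegral_mul_const (f := fun y => h ((2⁻¹ : ℝ) • (s + t), y)) _
    (hh.comp measurable_prodMk_left)]
  refine hρ _ _ _ (hf.comp measurable_prodMk_left) (hg.comp measurable_prodMk_left)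
    ((hh.comp measurable_prodMk_left).mul_const _) fun x y => ?_
  refine (H (s, x) (t, y)).trans (le_of_eq ?_)
  rw [mul_pow, ← hsq, mul_assoc, ← ENNReal.ofReal_mul (by positivity), ← Real.exp_add]
  simp [add_div]

end

lemma prekopaLeindler_pi_gaussianReal (n : ℕ) :
    PrekopaLeindler (Measure.pi fun _ : Fin n => gaussianReal 0 1) fun x => ∑ i, x i ^ 2 := by
  induction n with
  | zero =>
    intro f g h hf hg hh H
    rw [Measure.pi_of_empty, lintegral_dirac' _ hf, lintegral_dirac' _ hg, lintegral_dirac' _ hh]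
    set z : Fin 0 → ℝ := fun a => isEmptyElim a
    simpa [Subsingleton.elim _ z] using H z z
  | succ n ih =>
    have hmp := (measurePreserving_piFinSuccAbove
      (fun _ : Fin (n + 1) => gaussianReal 0 1) 0).symm
    rw [← hmp.map_eq]
    refine (prekopaLeindler_gaussianReal.prod ih).map (MeasurableEquiv.measurable _)
      (fun x y => ?_) fun x y => ?_
    · ext i
      refine Fin.cases ?_ (fun j => ?_) i <;>
        simp [MeasurableEquiv.piFinSuccAbove, Fin.insertNthEquiv, mul_add]
    · simp [MeasurableEquiv.piFinSuccAbove, Fin.insertNthEquiv, Fin.sum_univ_succ]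

section

variable {E : Type*} [NormedAddCommGroup E] [InnerProductSpace ℝ E] [FiniteDimensional ℝ E]
  [MeasurableSpace E] [BorelSpace E]

lemma prekopaLeindler_stdGaussian : PrekopaLeindler (stdGaussian E) fun x => ‖x‖ ^ 2 := by
  refine (prekopaLeindler_pi_gaussianReal _).map (by fun_prop) (fun x y => ?_) fun x y => ?_
  · simp [Finset.smul_sum, mul_smul, add_smul, Finset.sum_add_distrib]
  · rw [← Finset.sum_sub_distrib]
    simp_rw [← sub_smul]
    rw [← real_inner_self_eq_norm_sq, (stdOrthonormalBasis ℝ E).orthonormal.inner_sum]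
    simp [sq]

open scoped RealInnerProductSpace

/-- For the standard Gaussian measure conditioned on a symmetric convex set, linear functionals
have Gaussian tails. -/
lemma stdGaussian_inter_lt_abs_inner_le {K : Set E} (hK : MeasurableSet K) (hKc : Convex ℝ K)
    (hKs : ∀ x ∈ K, -x ∈ K) (w : E) {a v : ℝ} (ha : 0 ≤ a) (hv : 0 < v) (hw : ‖w‖ ^ 2 ≤ v) :
    stdGaussian E (K ∩ {x | a < |⟪w, x⟫|}) ≤
      .ofReal (2 * Real.exp (-(a ^ 2 / (2 * v)))) * stdGaussian E K := by
  set γ := stdGaussian E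
  have hmeas : Measurable fun x : E => ⟪w, x⟫ := by fun_prop
  set R := K ∩ {x | a < ⟪w, x⟫} with hR
  set R' := K ∩ {x | ⟪w, x⟫ < -a} with hR'
  have hRm : MeasurableSet R := hK.inter (measurableSet_lt measurable_const hmeas)
  have hRm' : MeasurableSet R' := hK.inter (measurableSet_lt hmeas measurable_const)
  set e := ENNReal.ofReal (Real.exp (-(a ^ 2 / (2 * v)))) with he
  have hsymm : γ R' = γ R := by
    have h1 : γ.map (LinearIsometryEquiv.neg ℝ (E := E)) = γ := stdGaussian_map _
    rw [← h1, Measure.map_apply (by fun_prop) hRm, h1]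
    congr 1
    ext x
    have : -x ∈ K ↔ x ∈ K := ⟨fun h => by simpa using hKs _ h, hKs x⟩
    simp [hR, hR', this, lt_neg]
  have hprod : γ R * γ R' ≤ (γ K * e) ^ 2 := by
    have := prekopaLeindler_stdGaussian (E := E) (R.indicator 1) (R'.indicator 1)
      (fun x => K.indicator 1 x * e) (measurable_one.indicator hRm)
      (measurable_one.indicator hRm') ((measurable_one.indicator hK).mul_const _) ?_
    · rwa [lintegral_indicator_one hRm, lintegral_indicator_one hRm',
        lintegral_mul_const _ (measurable_one.indicator hK), lintegral_indicator_one hK] at this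
    intro x y
    by_cases hx : x ∈ R
    swap
    · simp [hx]
    by_cases hy : y ∈ R'
    swap
    · simp [hy]
    have hmid : (2⁻¹ : ℝ) • (x + y) ∈ K := by
      rw [smul_add]
      exact hKc hx.1 hy.1 (by norm_num) (by norm_num) (by norm_num)
    have hxy : 2 * a ≤ ‖w‖ * ‖x - y‖ := by
      refine le_trans ?_ (real_inner_le_norm w (x - y))
      rw [inner_sub_right]
      have h1 : a < ⟪w, x⟫ := hx.2
      have h2 : ⟪w, y⟫ < -a := hy.2
      linarith
    have hxy2 : a ^ 2 / v ≤ ‖x - y‖ ^ 2 / 4 := by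
      rw [div_le_div_iff₀ hv (by norm_num)]
      nlinarith [mul_le_mul_of_nonneg_right hw (sq_nonneg ‖x - y‖)]
    simp only [indicator_of_mem hx, indicator_of_mem hy, indicator_of_mem hmid, Pi.one_apply,
      one_mul]
    rw [he, ← ENNReal.ofReal_pow (by positivity), ← ENNReal.ofReal_mul (by positivity),
      ← Real.exp_nat_mul, ← Real.exp_add, ENNReal.one_le_ofReal, Real.one_le_exp_iff]
    have : (2 : ℕ) * -(a ^ 2 / (2 * v)) = -(a ^ 2 / v) := by
      push_cast
      field_simp
    rw [this]
    linarith
  rw [hsymm, ← sq, ENNReal.pow_le_pow_left_iff two_ne_zero] at hprod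
  have hunion : K ∩ {x | a < |⟪w, x⟫|} ⊆ R ∪ R' := by
    rintro x ⟨hx, hx'⟩
    rcases lt_abs.1 (show a < |⟪w, x⟫| from hx') with h | h
    · exact .inl ⟨hx, h⟩
    · exact .inr ⟨hx, by simp only [mem_ofPred_eq]; linarith⟩
  calc γ (K ∩ {x | a < |⟪w, x⟫|}) ≤ γ R + γ R' :=
        (measure_mono hunion).trans (measure_union_le _ _)
    _ ≤ γ K * e + γ K * e := by rw [hsymm]; gcongr
    _ = _ := by rw [ENNReal.ofReal_mul (by norm_num)]; simp; ring

end

section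

variable {E : Type*} [NormedAddCommGroup E] [InnerProductSpace ℝ E] [FiniteDimensional ℝ E]
  [MeasurableSpace E] [BorelSpace E]

open scoped RealInnerProductSpace Matrix MatrixOrder

/-- A weak form of Šidák's inequality for the standard Gaussian measure. -/
lemma le_stdGaussian_forall_abs_inner_le {ι : Type*} (s : Finset ι) (w : ι → E) (a v : ι → ℝ)
    (ha : ∀ k, 0 ≤ a k) (hv : ∀ k, 0 < v k) (hw : ∀ k, ‖w k‖ ^ 2 ≤ v k)
    (h2 : ∀ k, 2 ≤ a k ^ 2 / (2 * v k)) :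
    ENNReal.ofReal (Real.exp (-∑ k ∈ s, 4 * Real.exp (-(a k ^ 2 / (2 * v k))))) ≤
      stdGaussian E {x | ∀ k ∈ s, |⟪w k, x⟫| ≤ a k} := by
  classical
  induction s using Finset.induction_on with
  | empty => simp
  | insert k s hks ih =>
    set γ := stdGaussian E
    set K := {x : E | ∀ k ∈ s, |⟪w k, x⟫| ≤ a k} with hKdef
    have hK_eq : K = ⋂ k ∈ s, {x | |⟪w k, x⟫| ≤ a k} := by ext; simp [hKdef]
    have hK : MeasurableSet K := by
      rw [hK_eq]
      exact s.measurableSet_biInter fun k _ => measurableSet_le (by fun_prop) (by fun_prop)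
    have hKc : Convex ℝ K := by
      rw [hK_eq]
      refine convex_iInter₂ fun k _ x hx y hy p q hp hq hpq => ?_
      simp only [mem_ofPred_eq, inner_add_right, inner_smul_right] at hx hy ⊢
      calc |p * ⟪w k, x⟫ + q * ⟪w k, y⟫| ≤ p * |⟪w k, x⟫| + q * |⟪w k, y⟫| := by
            refine (abs_add_le _ _).trans ?_
            rw [abs_mul, abs_mul, abs_of_nonneg hp, abs_of_nonneg hq]
        _ ≤ p * a k + q * a k := by gcongr
        _ = a k := by rw [← add_mul, hpq, one_mul]
    have hKs : ∀ x ∈ K, -x ∈ K := fun x hx j hj => by simpa using hx j hj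
    have htail := stdGaussian_inter_lt_abs_inner_le hK hKc hKs (w k) (ha k) (hv k) (hw k)
    set y := Real.exp (-(a k ^ 2 / (2 * v k)))
    have hy0 : 0 < y := Real.exp_pos _
    have hy4 : y ≤ 1 / 4 := by
      have h1 : y ≤ Real.exp (-1 + -1) := Real.exp_le_exp.2 (by linarith [h2 k])
      have h3 : Real.exp (-1) ≤ 1 / 2 := by
        rw [Real.exp_neg, one_div]
        exact inv_anti₀ (by norm_num) (by linarith [Real.add_one_le_exp 1])
      rw [Real.exp_add] at h1
      nlinarith [Real.exp_pos (-1)]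
    have hey : Real.exp (-(4 * y)) + 2 * y ≤ 1 := by
      have h1 : Real.exp (-(4 * y)) ≤ (1 + 4 * y)⁻¹ := by
        rw [Real.exp_neg]
        exact inv_anti₀ (by positivity) (by linarith [Real.add_one_le_exp (4 * y)])
      have h3 : (1 + 4 * y)⁻¹ ≤ 1 - 2 * y := by
        rw [inv_le_iff_one_le_mul₀ (by positivity)]
        nlinarith
      linarith
    have hsplit : γ K ≤ γ {x | ∀ j ∈ insert k s, |⟪w j, x⟫| ≤ a j} +
        γ (K ∩ {x | a k < |⟪w k, x⟫|}) := by
      refine (measure_mono fun x hx => ?_).trans (measure_union_le _ _)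
      by_cases h : |⟪w k, x⟫| ≤ a k
      · exact .inl ((Finset.forall_mem_insert _ _ _).2 ⟨h, hx⟩)
      · exact .inr ⟨hx, not_le.1 h⟩
    have hmain : ENNReal.ofReal (Real.exp (-(4 * y))) * γ K ≤
        γ {x | ∀ j ∈ insert k s, |⟪w j, x⟫| ≤ a j} := by
      have hfin : ENNReal.ofReal (2 * y) * γ K ≠ ∞ :=
        ENNReal.mul_ne_top ENNReal.ofReal_ne_top (measure_ne_top _ _)
      refine (ENNReal.add_le_add_iff_right hfin).1 ?_
      calc _ = ENNReal.ofReal (Real.exp (-(4 * y)) + 2 * y) * γ K := by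
            rw [ENNReal.ofReal_add (by positivity) (by positivity), add_mul]
        _ ≤ 1 * γ K := by
            gcongr
            simpa using hey
        _ ≤ _ := by
            rw [one_mul]
            exact hsplit.trans (by gcongr)
    rw [Finset.sum_insert hks, neg_add, Real.exp_add, ENNReal.ofReal_mul (by positivity)]
    exact (mul_le_mul_right ih _).trans hmain

/-- A weak form of Šidák's inequality for jointly Gaussian random variables. -/
lemma le_measure_forall_abs_sum_le {Ω : Type*} [MeasurableSpace Ω] (P : Measure Ω)
    [IsProbabilityMeasure P] {κ : Type*} [Fintype κ] [DecidableEq κ] (X : κ → Ω → ℝ)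
    {S : Matrix κ κ ℝ} (hS : S.PosSemidef)
    (hX : ∀ c : κ → ℝ, P.map (fun ω => ∑ i, c i * X i ω) =
      gaussianReal 0 (c ⬝ᵥ S *ᵥ c).toNNReal)
    {ι : Type*} (s : Finset ι) (c : ι → κ → ℝ) (a v : ι → ℝ)
    (ha : ∀ k, 0 ≤ a k) (hv : ∀ k, 0 < v k) (hc : ∀ k, c k ⬝ᵥ S *ᵥ c k ≤ v k)
    (h2 : ∀ k, 2 ≤ a k ^ 2 / (2 * v k)) :
    ENNReal.ofReal (Real.exp (-∑ k ∈ s, 4 * Real.exp (-(a k ^ 2 / (2 * v k))))) ≤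
      P {ω | ∀ k ∈ s, |∑ i, c k i * X i ω| ≤ a k} := by
  have hmeas : ∀ i, AEMeasurable (X i) P := fun i => by
    have h := hX (Pi.single i 1)
    simp only [Pi.single_apply, ite_mul, one_mul, zero_mul, Finset.sum_ite_eq', Finset.mem_univ,
      if_true] at h
    refine AEMeasurable.of_map_ne_zero ?_
    rw [h]
    exact IsProbabilityMeasure.ne_zero _
  set Z : Ω → EuclideanSpace ℝ κ := fun ω => WithLp.toLp 2 fun i => X i ω
  have hZ : AEMeasurable Z P :=
    (WithLp.measurable_toLp 2 _).comp_aemeasurable (aemeasurable_pi_lambda _ hmeas)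
  have hin : ∀ (u : κ → ℝ) ω, ⟪WithLp.toLp 2 u, Z ω⟫ = ∑ i, u i * X i ω := fun u ω => by
    simp [Z, PiLp.inner_apply, mul_comm]
  have hlaw : P.map Z = multivariateGaussian 0 S := by
    have : IsProbabilityMeasure (P.map Z) := Measure.isProbabilityMeasure_map hZ
    refine Measure.ext_of_charFun (funext fun u => ?_)
    have hu : charFun (P.map Z) u = charFun (P.map fun ω => ∑ i, u i * X i ω) 1 := by
      have hm : AEMeasurable (fun ω => ∑ i, u i * X i ω) P :=
        Finset.aemeasurable_fun_sum _ fun i _ => (hmeas i).const_mul _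
      rw [charFun_apply, charFun_apply, integral_map hZ (by fun_prop),
        integral_map hm (by fun_prop)]
      congr with ω
      rw [real_inner_comm, ← hin]
      simp
    rw [hu, hX, charFun_gaussianReal, charFun_multivariateGaussian hS]
    have := hS.dotProduct_mulVec_nonneg u
    simp at this
    simp [Real.coe_toNNReal _ this]
  set B : EuclideanSpace ℝ κ →L[ℝ] EuclideanSpace ℝ κ :=
    Matrix.toEuclideanCLM (𝕜 := ℝ) (CFC.sqrt S)
  have hlaw' : P.map Z = (stdGaussian (EuclideanSpace ℝ κ)).map B := by
    rw [hlaw, multivariateGaussian]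
    simp [B]
  have hw : ∀ k, ‖B.adjoint (WithLp.toLp 2 (c k))‖ ^ 2 ≤ v k := fun k => by
    refine le_of_eq_of_le ?_ (hc k)
    have h1 := covarianceBilin_multivariateGaussian (μ := 0) hS (WithLp.toLp 2 (c k))
      (WithLp.toLp 2 (c k))
    rw [← hlaw, hlaw', covarianceBilin_map (by exact IsGaussian.memLp_two_id),
      covarianceBilin_stdGaussian] at h1
    rw [← real_inner_self_eq_norm_sq]
    exact h1
  have hmain := le_stdGaussian_forall_abs_inner_le s
    (fun k => B.adjoint (WithLp.toLp 2 (c k))) a v ha hv hw h2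
  refine hmain.trans (le_of_eq ?_)
  have hms : MeasurableSet {x : EuclideanSpace ℝ κ | ∀ k ∈ s, |⟪WithLp.toLp 2 (c k), x⟫| ≤ a k} := by
    have : {x : EuclideanSpace ℝ κ | ∀ k ∈ s, |⟪WithLp.toLp 2 (c k), x⟫| ≤ a k} =
        ⋂ k ∈ s, {x | |⟪WithLp.toLp 2 (c k), x⟫| ≤ a k} := by ext; simp
    rw [this]
    exact s.measurableSet_biInter fun k _ => measurableSet_le (by fun_prop) (by fun_prop)
  have h3 := Measure.map_apply_of_aemeasurable hZ hms
  rw [hlaw', Measure.map_apply (by fun_prop) hms] at h3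
  simp_rw [ContinuousLinearMap.adjoint_inner_left]
  refine h3.trans ?_
  simp only [preimage_ofPred_eq, hin]

end

lemma covKernel_neg {μ : Measure ℝ} (t : ℝ) : covKernel μ (-t) = covKernel μ t := by
  simp [covKernel]

open scoped Matrix in
lemma IsSGP.map_sum {Ω : Type*} [MeasurableSpace Ω] {P : Measure Ω} {μ : Measure ℝ}
    {F : ℝ → Ω → ℝ} (hF : IsSGP P μ F) {κ : Type*} [Fintype κ] (t c : κ → ℝ) :
    P.map (fun ω => ∑ i, c i * F (t i) ω) =
      gaussianReal 0 (c ⬝ᵥ (Matrix.of fun i j => covKernel μ (t i - t j)) *ᵥ c).toNNReal := by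
  set e := Fintype.equivFin κ
  have h := hF.2 (Fintype.card κ) (t ∘ e.symm) (c ∘ e.symm)
  simp only [Function.comp_apply] at h
  have h1 : ∀ ω, ∑ i, c (e.symm i) * F (t (e.symm i)) ω = ∑ i, c i * F (t i) ω := fun ω =>
    Equiv.sum_comp e.symm fun i => c i * F (t i) ω
  have h2 : ∀ x, ∑ j, c x * c (e.symm j) * covKernel μ (t x - t (e.symm j)) =
      ∑ j, c x * c j * covKernel μ (t x - t j) := fun x =>
    Equiv.sum_comp e.symm fun j => c x * c j * covKernel μ (t x - t j)
  simp_rw [h1, h2] at h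
  rw [Equiv.sum_comp e.symm fun i => ∑ j, c i * c j * covKernel μ (t i - t j)] at h
  rw [h]
  simp only [dotProduct, Matrix.mulVec, Matrix.of_apply, Finset.mul_sum]
  congr 2
  refine Finset.sum_congr rfl fun i _ => Finset.sum_congr rfl fun j _ => by ring

section

variable {μ : Measure ℝ} [IsProbabilityMeasure μ]

lemma covKernel_zero : covKernel μ 0 = 1 := by simp [covKernel]

lemma integrable_cos_mul (t : ℝ) : Integrable (fun l => Real.cos (l * t)) μ :=
  Integrable.of_bound (by fun_prop) 1 (.of_forall fun l => by simpa using Real.abs_cos_le_one _)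

open scoped Matrix in
lemma posSemidef_covKernel {κ : Type*} [Fintype κ] (t : κ → ℝ) :
    (Matrix.of fun i j => covKernel μ (t i - t j)).PosSemidef := by
  refine Matrix.PosSemidef.of_dotProduct_mulVec_nonneg ?_ fun c => ?_
  · ext i j
    simp only [Matrix.conjTranspose_apply, Matrix.of_apply, star_trivial]
    rw [← covKernel_neg, neg_sub]
  · have hform : star c ⬝ᵥ (Matrix.of fun i j => covKernel μ (t i - t j)) *ᵥ c =
        ∫ l, (∑ i, c i * Real.cos (l * t i)) ^ 2 + (∑ i, c i * Real.sin (l * t i)) ^ 2 ∂μ := by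
      have hpt : ∀ l, (∑ i, c i * Real.cos (l * t i)) ^ 2 + (∑ i, c i * Real.sin (l * t i)) ^ 2 =
          ∑ i, ∑ j, c i * c j * Real.cos (l * (t i - t j)) := by
        intro l
        rw [sq, sq, Finset.sum_mul_sum, Finset.sum_mul_sum, ← Finset.sum_add_distrib]
        refine Finset.sum_congr rfl fun i _ => ?_
        rw [← Finset.sum_add_distrib]
        refine Finset.sum_congr rfl fun j _ => ?_
        rw [mul_sub, Real.cos_sub]
        ring
      simp_rw [hpt]
      rw [integral_finsetSum _ fun i _ => integrable_finsetSum _ fun j _ =>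
        (integrable_cos_mul _).const_mul _]
      simp only [dotProduct, Matrix.mulVec, Matrix.of_apply, star_trivial, Finset.mul_sum]
      refine Finset.sum_congr rfl fun i _ => ?_
      rw [integral_finsetSum _ fun j _ => (integrable_cos_mul _).const_mul _]
      refine Finset.sum_congr rfl fun j _ => ?_
      rw [integral_const_mul, covKernel]
      ring
    rw [hform]
    exact integral_nonneg fun l => by positivity

lemma two_sub_two_mul_cos_le {δ : ℝ} (hδ : 0 < δ) (l h : ℝ) :
    2 - 2 * Real.cos (l * h) ≤ 4 * (1 + |l| ^ δ) * |h| ^ (min δ 1) := by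
  have hm : 0 < min δ 1 := lt_min hδ one_pos
  have hcos : 2 - 2 * Real.cos (l * h) ≤ 4 * |l * h| ^ (min δ 1) := by
    rcases le_total |l * h| 1 with h1 | h1
    · have h2 : |l * h| ^ (1 : ℝ) ≤ |l * h| ^ (min δ 1) :=
        Real.rpow_le_rpow_of_exponent_ge' (abs_nonneg _) h1 hm.le (min_le_right _ _)
      rw [Real.rpow_one] at h2
      have h3 := Real.one_sub_sq_div_two_le_cos (x := l * h)
      have h4 : (l * h) ^ 2 ≤ |l * h| := by
        rw [← sq_abs]
        nlinarith [abs_nonneg (l * h)]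
      nlinarith [abs_nonneg (l * h)]
    · have := Real.one_le_rpow h1 hm.le
      linarith [Real.neg_one_le_cos (l * h)]
  have hl : |l| ^ (min δ 1) ≤ 1 + |l| ^ δ := by
    rcases le_total |l| 1 with h1 | h1
    · have := Real.rpow_le_one (abs_nonneg l) h1 hm.le
      linarith [Real.rpow_nonneg (abs_nonneg l) δ]
    · have := Real.rpow_le_rpow_of_exponent_le h1 (min_le_left δ 1)
      linarith
  rw [abs_mul, Real.mul_rpow (abs_nonneg _) (abs_nonneg _)] at hcos
  refine hcos.trans ?_
  rw [mul_assoc]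
  gcongr

lemma exists_two_sub_two_mul_covKernel_le {δ : ℝ} (hδ : 0 < δ)
    (hmom : Integrable (fun l : ℝ => (abs l) ^ δ) μ) :
    ∃ C ≥ (1 : ℝ), ∃ r : ℝ, 0 < r ∧ r < 1 ∧
      ∀ n : ℕ, 2 - 2 * covKernel μ ((2⁻¹ : ℝ) ^ n) ≤ C * r ^ (4 * n) := by
  have hm : 0 < min δ 1 := lt_min hδ one_pos
  have hI : 0 ≤ ∫ l, |l| ^ δ ∂μ := integral_nonneg fun l => Real.rpow_nonneg (abs_nonneg l) δ
  refine ⟨4 * (1 + ∫ l, |l| ^ δ ∂μ), by linarith, (2⁻¹ : ℝ) ^ (min δ 1 / 4), by positivity,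
    Real.rpow_lt_one (by norm_num) (by norm_num) (by positivity), fun n => ?_⟩
  have hr : ((2⁻¹ : ℝ) ^ (min δ 1 / 4)) ^ (4 * n) = |(2⁻¹ : ℝ) ^ n| ^ (min δ 1) := by
    rw [abs_of_pos (by positivity), ← Real.rpow_natCast, ← Real.rpow_natCast,
      ← Real.rpow_mul (by norm_num), ← Real.rpow_mul (by norm_num)]
    congr 1
    push_cast
    ring
  have hint : 2 - 2 * covKernel μ ((2⁻¹ : ℝ) ^ n) =
      ∫ l, 2 - 2 * Real.cos (l * (2⁻¹ : ℝ) ^ n) ∂μ := by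
    rw [integral_sub (integrable_const _) ((integrable_cos_mul _).const_mul _),
      integral_const_mul]
    simp [covKernel]
  rw [hint, hr]
  refine (integral_mono ((integrable_const _).sub ((integrable_cos_mul _).const_mul _))
    ((((integrable_const 1).add hmom).const_mul 4).mul_const _)
    fun l => two_sub_two_mul_cos_le hδ l _).trans (le_of_eq ?_)
  rw [integral_mul_const, integral_const_mul]
  simp only [Pi.add_apply]
  rw [integral_add (integrable_const _) hmom]
  simp

lemma IsSGP.map_eq {Ω : Type*} [MeasurableSpace Ω] {P : Measure Ω} {F : ℝ → Ω → ℝ}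
    (hF : IsSGP P μ F) (t : ℝ) : P.map (F t) = gaussianReal 0 1 := by
  simpa [covKernel_zero] using hF.2 1 (fun _ => t) fun _ => 1

lemma IsSGP.aemeasurable {Ω : Type*} [MeasurableSpace Ω] {P : Measure Ω} {F : ℝ → Ω → ℝ}
    (hF : IsSGP P μ F) (t : ℝ) : AEMeasurable (F t) P := by
  refine AEMeasurable.of_map_ne_zero ?_
  rw [hF.map_eq]
  exact IsProbabilityMeasure.ne_zero _

/-- A weak form of Šidák's inequality for weighted increments of a stationary Gaussian process. -/
lemma IsSGP.le_measure_forall_abs_sub_le {Ω : Type*} [MeasurableSpace Ω] {P : Measure Ω}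
    [IsProbabilityMeasure P] {F : ℝ → Ω → ℝ} (hF : IsSGP P μ F) {ι : Type*} [Fintype ι]
    (x y ε a v : ι → ℝ) (ha : ∀ k, 0 ≤ a k) (hv : ∀ k, 0 < v k)
    (hvar : ∀ k, 1 - 2 * ε k * covKernel μ (x k - y k) + ε k ^ 2 ≤ v k)
    (h2 : ∀ k, 2 ≤ a k ^ 2 / (2 * v k)) :
    ENNReal.ofReal (Real.exp (-∑ k, 4 * Real.exp (-(a k ^ 2 / (2 * v k))))) ≤
      P {ω | ∀ k, |F (x k) ω - ε k * F (y k) ω| ≤ a k} := by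
  classical
  have h := le_measure_forall_abs_sum_le P (fun i => F (Sum.elim x y i))
    (posSemidef_covKernel (μ := μ) (Sum.elim x y)) (hF.map_sum (Sum.elim x y)) Finset.univ
    (fun k => Sum.elim (Pi.single k 1) (Pi.single k (-ε k))) a v ha hv (fun k => ?_) h2
  · simpa [Pi.single_apply, ← sub_eq_add_neg] using h
  · refine le_of_eq_of_le ?_ (hvar k)
    have := covKernel_neg (μ := μ) (x k - y k)
    rw [neg_sub] at this
    simp [dotProduct, Matrix.mulVec, Pi.single_apply, covKernel_zero, this]
    ring

end

/-- Chaining along dyadic points. -/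
lemma abs_le_of_forall_dyadic {f : ℝ → ℝ} (hf : Continuous f) {N : ℕ} {a : ℕ → ℝ} {ℓ : ℝ}
    (ha : ∀ n, 0 ≤ a n) (hsum : ∀ n, ∑ k ∈ Finset.range n, a k ≤ ℓ)
    (H : ∀ n j : ℕ, j ≤ N * 2 ^ n → |f (j * (2⁻¹ : ℝ) ^ n) -
      (if n = 0 then 0 else 1) * f (((j : ℝ) - 1) * (2⁻¹ : ℝ) ^ n)| ≤ a n)
    {t : ℝ} (ht0 : 0 ≤ t) (htN : t ≤ N) : |f t| ≤ ℓ := by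
  have hdyadic : ∀ n j : ℕ, j ≤ N * 2 ^ n →
      |f (j * (2⁻¹ : ℝ) ^ n)| ≤ ∑ k ∈ Finset.range (n + 1), a k := by
    intro n
    induction n with
    | zero =>
      intro j hj
      simpa using H 0 j hj
    | succ n ih =>
      intro j hj
      rw [Finset.sum_range_succ]
      rcases Nat.even_or_odd' j with ⟨i, rfl | rfl⟩
      · have h1 := ih i (by rw [pow_succ] at hj; lia)
        have h2 : ((2 * i : ℕ) : ℝ) * (2⁻¹ : ℝ) ^ (n + 1) = i * (2⁻¹ : ℝ) ^ n := by
          push_cast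
          ring
        rw [h2]
        linarith [ha (n + 1)]
      · have h1 := ih i (by rw [pow_succ] at hj; lia)
        have h2 : (((2 * i + 1 : ℕ) : ℝ) - 1) * (2⁻¹ : ℝ) ^ (n + 1) = i * (2⁻¹ : ℝ) ^ n := by
          push_cast
          ring
        have h3 := H (n + 1) (2 * i + 1) hj
        rw [h2, if_neg n.succ_ne_zero, one_mul] at h3
        have := abs_sub_abs_le_abs_sub (f ((2 * i + 1 : ℕ) * (2⁻¹ : ℝ) ^ (n + 1)))
          (f (i * (2⁻¹ : ℝ) ^ n))
        linarith
  have htend : Filter.Tendsto (fun n : ℕ => (⌊t * 2 ^ n⌋₊ : ℝ) * (2⁻¹ : ℝ) ^ n) Filter.atTop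
      (nhds t) := by
    have h1 := (tendsto_nat_floor_mul_div_atTop ht0).comp
      (tendsto_pow_atTop_atTop_of_one_lt (one_lt_two (α := ℝ)))
    refine h1.congr fun n => ?_
    simp [div_eq_mul_inv]
  refine le_of_tendsto ((hf.tendsto t).comp htend).abs (.of_forall fun n => ?_)
  refine (hdyadic n _ ?_).trans (hsum _)
  have : t * 2 ^ n ≤ ((N * 2 ^ n : ℕ) : ℝ) := by
    push_cast
    gcongr
  exact Nat.floor_le_of_le this

lemma exists_sum_two_pow_mul_exp_le {ρ : ℝ} (hρ : 1 < ρ) :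
    ∃ D > (0 : ℝ), ∀ x ≥ (2 : ℝ), ∀ M : ℕ,
      ∑ n ∈ Finset.range M, 2 ^ n * Real.exp (-(x * ρ ^ n)) ≤ D * Real.exp (-(x / 2)) := by
  obtain ⟨k, hk⟩ := pow_unbounded_of_one_lt 4 hρ
  have hρ0 : 0 < ρ := one_pos.trans hρ
  refine ⟨k.factorial * 2, by positivity, fun x hx M => ?_⟩
  have hterm : ∀ n : ℕ, 2 ^ n * Real.exp (-(x * ρ ^ n)) ≤
      k.factorial * Real.exp (-(x / 2)) * (2⁻¹ : ℝ) ^ n := by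
    intro n
    have h1 : 1 ≤ ρ ^ n := one_le_pow₀ hρ.le
    have h2 : Real.exp (-(x * ρ ^ n)) ≤ Real.exp (-(x / 2)) * Real.exp (-(ρ ^ n)) := by
      rw [← Real.exp_add]
      gcongr
      nlinarith
    have h3 : (4 : ℝ) ^ n / k.factorial ≤ Real.exp (ρ ^ n) := by
      refine le_trans ?_ (Real.pow_div_factorial_le_exp (ρ ^ n) (by positivity) k)
      rw [← pow_mul, mul_comm n k, pow_mul]
      gcongr
    have h4 : Real.exp (-(ρ ^ n)) ≤ k.factorial * (4⁻¹ : ℝ) ^ n := by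
      rw [Real.exp_neg, inv_pow, inv_le_comm₀ (Real.exp_pos _) (by positivity), mul_inv, inv_inv,
        mul_comm]
      exact h3
    calc 2 ^ n * Real.exp (-(x * ρ ^ n))
        ≤ 2 ^ n * (Real.exp (-(x / 2)) * (k.factorial * (4⁻¹ : ℝ) ^ n)) := by
          gcongr
          exact h2.trans (by gcongr)
      _ = k.factorial * Real.exp (-(x / 2)) * (2 ^ n * (4⁻¹ : ℝ) ^ n) := by ring
      _ = _ := by rw [← mul_pow]; norm_num
  refine (Finset.sum_le_sum fun n _ => hterm n).trans ?_
  rw [← Finset.mul_sum]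
  have h5 : ∑ n ∈ Finset.range M, (2⁻¹ : ℝ) ^ n ≤ 2 := by
    refine ((summable_geometric_of_lt_one (by norm_num) (by norm_num)).sum_le_tsum _
      fun _ _ => by positivity).trans_eq ?_
    rw [tsum_geometric_of_lt_one (by norm_num) (by norm_num)]
    norm_num
  nlinarith [Real.exp_pos (-(x / 2)), mul_pos (Nat.cast_pos (α := ℝ).2 k.factorial_pos)
    (Real.exp_pos (-(x / 2)))]

lemma gaussianReal_setOf_abs_le_le {y : ℝ} (hy : 0 ≤ y) :
    gaussianReal 0 1 {x | |x| ≤ y} ≤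
      ENNReal.ofReal (Real.exp (-((√(2 * Real.pi))⁻¹ * Real.exp (-(y ^ 2 + 1))))) := by
  set q := (√(2 * Real.pi))⁻¹ * Real.exp (-(y ^ 2 + 1)) with hq
  have hq0 : 0 ≤ q := by positivity
  have hlow : ENNReal.ofReal q ≤ gaussianReal 0 1 (Ioc y (y + 1)) := by
    rw [gaussianReal_apply _ one_ne_zero]
    calc ENNReal.ofReal q = ∫⁻ _ in Ioc y (y + 1), ENNReal.ofReal q := by simp
      _ ≤ _ := setLIntegral_mono' measurableSet_Ioc fun x hx => by
        refine ENNReal.ofReal_le_ofReal ?_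
        simp only [gaussianPDFReal, NNReal.coe_one, mul_one, sub_zero, hq]
        gcongr
        have h1 : x ^ 2 ≤ (y + 1) ^ 2 := by
          have := hx.1
          have := hx.2
          gcongr
          linarith
        nlinarith [sq_nonneg (y - 1)]
  have hsub : {x : ℝ | |x| ≤ y} ⊆ (Ioc y (y + 1))ᶜ := fun x hx hx' =>
    (hx'.1.trans_le (le_abs_self x)).not_ge hx
  calc gaussianReal 0 1 {x | |x| ≤ y} ≤ gaussianReal 0 1 (Ioc y (y + 1))ᶜ := measure_mono hsub
    _ = 1 - gaussianReal 0 1 (Ioc y (y + 1)) := prob_compl_eq_one_sub measurableSet_Ioc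
    _ ≤ 1 - ENNReal.ofReal q := by gcongr
    _ = ENNReal.ofReal (1 - q) := by rw [ENNReal.ofReal_sub _ hq0, ENNReal.ofReal_one]
    _ ≤ _ := ENNReal.ofReal_le_ofReal (Real.one_sub_le_exp_neg q)

/-- A chaining lower bound for the probability that a stationary Gaussian process stays in a
strip. -/
lemma IsSGP.le_measure_forall_mem_Icc_abs_le {Ω : Type*} [MeasurableSpace Ω] {P : Measure Ω}
    [IsProbabilityMeasure P] {μ : Measure ℝ} [IsProbabilityMeasure μ] {F : ℝ → Ω → ℝ}
    (hF : IsSGP P μ F) {C r : ℝ} (hC : 1 ≤ C) (hr0 : 0 < r) (hr1 : r < 1)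
    (hcov : ∀ n : ℕ, 2 - 2 * covKernel μ ((2⁻¹ : ℝ) ^ n) ≤ C * r ^ (4 * n)) :
    ∃ β : ℝ, 0 < β ∧ β < 1 ∧ ∃ D > (0 : ℝ), ∀ T ≥ (1 : ℝ), ∀ ℓ > (0 : ℝ), 2 ≤ β * ℓ ^ 2 →
      ENNReal.ofReal (Real.exp (-(D * Real.exp (-(β * ℓ ^ 2 / 2)) * T))) ≤
        P {ω | ∀ t ∈ Icc (0 : ℝ) T, |F t ω| ≤ ℓ} := by
  obtain ⟨D, hD, hsum⟩ := exists_sum_two_pow_mul_exp_le (ρ := (r ^ 2)⁻¹)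
    ((one_lt_inv₀ (by positivity)).2 (pow_lt_one₀ hr0.le hr1 two_ne_zero))
  have hκ : 0 < 1 - r := by linarith
  set β := (1 - r) ^ 2 / (2 * C) with hβ
  refine ⟨β, by positivity, ?_, 12 * D, by positivity, fun T hT ℓ hℓ hℓ2 => ?_⟩
  · rw [hβ, div_lt_one (by positivity)]
    nlinarith
  set a : ℕ → ℝ := fun n => ℓ * (1 - r) * r ^ n with ha_def
  have ha : ∀ n, 0 ≤ a n := fun n => by positivity
  have hav : ∀ n, a n ^ 2 / (2 * (C * r ^ (4 * n))) = β * ℓ ^ 2 * (r ^ 2)⁻¹ ^ n := by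
    intro n
    rw [hβ, ha_def, inv_pow, ← pow_mul]
    field_simp
    ring
  have hasum : ∀ m, ∑ n ∈ Finset.range m, a n ≤ ℓ := by
    intro m
    rw [← Finset.mul_sum, mul_assoc, mul_neg_geom_sum]
    nlinarith [pow_pos hr0 m]
  set N := ⌈T⌉₊ with hN
  have hNT : (N : ℝ) ≤ 2 * T := by linarith [Nat.ceil_lt_add_one (zero_le_one.trans hT)]
  let E : ℕ → Set Ω := fun M => {ω | ∀ k : Σ n : Fin M, Fin (N * 2 ^ (n : ℕ) + 1),
    |F ((k.2 : ℕ) * (2⁻¹ : ℝ) ^ (k.1 : ℕ)) ω - (if (k.1 : ℕ) = 0 then 0 else 1) *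
      F ((((k.2 : ℕ) : ℝ) - 1) * (2⁻¹ : ℝ) ^ (k.1 : ℕ)) ω| ≤ a k.1}
  have hE : ∀ M, ENNReal.ofReal (Real.exp (-(12 * D * Real.exp (-(β * ℓ ^ 2 / 2)) * T))) ≤
      P (E M) := by
    intro M
    have h := hF.le_measure_forall_abs_sub_le
      (fun k : Σ n : Fin M, Fin (N * 2 ^ (n : ℕ) + 1) => (k.2 : ℕ) * (2⁻¹ : ℝ) ^ (k.1 : ℕ))
      (fun k => (((k.2 : ℕ) : ℝ) - 1) * (2⁻¹ : ℝ) ^ (k.1 : ℕ))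
      (fun k => if (k.1 : ℕ) = 0 then 0 else 1) (fun k => a k.1) (fun k => C * r ^ (4 * (k.1 : ℕ)))
      (fun k => ha _) (fun k => by positivity) (fun k => ?_) (fun k => ?_)
    · refine le_trans (ENNReal.ofReal_le_ofReal ?_) h
      gcongr
      rw [Fintype.sum_sigma]
      simp only [hav, Finset.sum_const, Finset.card_univ, Fintype.card_fin, nsmul_eq_mul]
      rw [Fin.sum_univ_eq_sum_range (fun n => ((N * 2 ^ n + 1 : ℕ) : ℝ) *
        (4 * Real.exp (-(β * ℓ ^ 2 * (r ^ 2)⁻¹ ^ n)))) M]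
      calc ∑ n ∈ Finset.range M, ((N * 2 ^ n + 1 : ℕ) : ℝ) *
            (4 * Real.exp (-(β * ℓ ^ 2 * (r ^ 2)⁻¹ ^ n)))
          ≤ ∑ n ∈ Finset.range M, 12 * T * (2 ^ n * Real.exp (-(β * ℓ ^ 2 * (r ^ 2)⁻¹ ^ n))) := by
            refine Finset.sum_le_sum fun n _ => ?_
            have h2 : (1 : ℝ) ≤ 2 ^ n := one_le_pow₀ one_le_two
            have h3 : ((N * 2 ^ n + 1 : ℕ) : ℝ) ≤ 3 * T * 2 ^ n := by
              push_cast
              nlinarith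
            nlinarith [Real.exp_pos (-(β * ℓ ^ 2 * (r ^ 2)⁻¹ ^ n))]
        _ ≤ 12 * T * (D * Real.exp (-(β * ℓ ^ 2 / 2))) := by
            rw [← Finset.mul_sum]
            gcongr
            exact hsum _ hℓ2 M
        _ = _ := by ring
    · have h1 : ((k.2 : ℕ) : ℝ) * (2⁻¹ : ℝ) ^ (k.1 : ℕ) -
          (((k.2 : ℕ) : ℝ) - 1) * (2⁻¹ : ℝ) ^ (k.1 : ℕ) = (2⁻¹ : ℝ) ^ (k.1 : ℕ) := by ring
      rw [h1]
      split_ifs with h0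
      · simpa [h0] using hC
      · linarith [hcov k.1]
    · rw [hav]
      refine hℓ2.trans (le_mul_of_one_le_right (by positivity) (one_le_pow₀ ?_))
      exact (one_le_inv₀ (by positivity)).2 (pow_le_one₀ hr0.le hr1.le)
  have hmeas : ∀ M, NullMeasurableSet (E M) P := by
    intro M
    simp only [E, ofPred_forall]
    refine .iInter fun k => nullMeasurableSet_le ?_ aemeasurable_const
    exact ((hF.aemeasurable _).sub ((hF.aemeasurable _).const_mul _)).abs
  have hanti : Antitone E := fun m n hmn ω hω k =>
    hω ⟨⟨k.1, k.1.2.trans_le hmn⟩, k.2⟩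
  have hinter : ⋂ M, E M ⊆ {ω | ∀ t ∈ Icc (0 : ℝ) T, |F t ω| ≤ ℓ} := by
    intro ω hω t ht
    refine abs_le_of_forall_dyadic (hF.1 ω) ha hasum (fun n j hj => ?_) ht.1
      (ht.2.trans (Nat.le_ceil T))
    exact mem_iInter.1 hω (n + 1) ⟨⟨n, n.lt_succ_self⟩, ⟨j, Nat.lt_succ_of_le hj⟩⟩
  refine le_trans ?_ (measure_mono hinter)
  exact ge_of_tendsto' (tendsto_measure_iInter_atTop hmeas hanti ⟨0, measure_ne_top _ _⟩) hE

theorem ball_lower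
    {Ω : Type*} [MeasurableSpace Ω] (P : Measure Ω) [IsProbabilityMeasure P]
    (μ : Measure ℝ) [IsProbabilityMeasure μ]
    (hsymm : μ.map (fun x => -x) = μ)
    (δ : ℝ) (hδ : 0 < δ) (hmom : Integrable (fun l : ℝ => (abs l) ^ δ) μ)
    (F : ℝ → Ω → ℝ) (hF : IsSGP P μ F) :
    ∃ ℓ₀ > (0:ℝ), ∃ c > (1:ℝ), ∀ T ≥ (1:ℝ), ∀ ℓ > ℓ₀,
      P {ω | c * |F 0 ω| ≤ ℓ} ^ (T : ℝ) ≤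
        P {ω | ∀ t ∈ Set.Icc (0:ℝ) T, |F t ω| ≤ ℓ} := by
  obtain ⟨C, hC, r, hr0, hr1, hcov⟩ := exists_two_sub_two_mul_covKernel_le hδ hmom
  obtain ⟨β, hβ0, hβ1, D, hD, hlow⟩ := hF.le_measure_forall_mem_Icc_abs_le hC hr0 hr1 hcov
  set s := √(2 * Real.pi) with hs
  have hs0 : 0 < s := by positivity
  set K := D * s * Real.exp 1 with hK
  have hc : 1 < 4 / β := by rw [one_lt_div hβ0]; linarith
  refine ⟨1 + 2 / β + 4 * K / β, by positivity, 4 / β, hc, fun T hT ℓ hℓ => ?_⟩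
  have hK0 : 0 < 4 * K / β := by positivity
  have hβ2 : 0 < 2 / β := by positivity
  have hℓ1 : 1 < ℓ := by linarith
  have hsq : ℓ ≤ ℓ ^ 2 := by nlinarith
  have h2 : 2 ≤ β * ℓ ^ 2 := by
    have : 2 / β ≤ ℓ ^ 2 := by linarith
    rwa [div_le_iff₀' hβ0] at this
  have hKℓ : K ≤ β * ℓ ^ 2 / 4 := by
    have : 4 * K / β ≤ ℓ ^ 2 := by linarith
    rw [div_le_iff₀' hβ0] at this
    linarith
  refine le_trans ?_ (hlow T hT ℓ (by linarith) h2)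
  set y := ℓ / (4 / β) with hy
  have hy0 : 0 ≤ y := by positivity
  have hball : P {ω | 4 / β * |F 0 ω| ≤ ℓ} ≤
      ENNReal.ofReal (Real.exp (-(s⁻¹ * Real.exp (-(y ^ 2 + 1))))) := by
    refine le_trans (le_of_eq ?_) (gaussianReal_setOf_abs_le_le hy0)
    rw [← hF.map_eq 0, Measure.map_apply_of_aemeasurable (hF.aemeasurable 0)
      (measurableSet_le (by fun_prop : Measurable fun x : ℝ => |x|) measurable_const)]
    congr 1
    ext ω
    simp [hy, le_div_iff₀' (by positivity : 0 < 4 / β)]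
  have hexp : D * Real.exp (-(β * ℓ ^ 2 / 2)) ≤ s⁻¹ * Real.exp (-(y ^ 2 + 1)) := by
    have h3 : y ^ 2 ≤ β * ℓ ^ 2 / 4 := by
      have : y ^ 2 = β ^ 2 * ℓ ^ 2 / 16 := by rw [hy]; field_simp; ring
      rw [this]
      nlinarith [mul_pos hβ0 (by positivity : 0 < ℓ ^ 2)]
    have h4 : K ≤ Real.exp (β * ℓ ^ 2 / 4) := by linarith [Real.add_one_le_exp (β * ℓ ^ 2 / 4)]
    have h5 : D * s ≤ Real.exp (β * ℓ ^ 2 / 4 - 1) := by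
      rw [Real.exp_sub, le_div_iff₀ (Real.exp_pos 1)]
      exact h4
    rw [← div_eq_inv_mul, le_div_iff₀ hs0]
    calc D * Real.exp (-(β * ℓ ^ 2 / 2)) * s = D * s * Real.exp (-(β * ℓ ^ 2 / 2)) := by ring
      _ ≤ Real.exp (β * ℓ ^ 2 / 4 - 1) * Real.exp (-(β * ℓ ^ 2 / 2)) := by gcongr
      _ = Real.exp (-(β * ℓ ^ 2 / 4 + 1)) := by rw [← Real.exp_add]; congr 1; ring
      _ ≤ _ := by gcongr
  calc P {ω | 4 / β * |F 0 ω| ≤ ℓ} ^ T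
      ≤ ENNReal.ofReal (Real.exp (-(s⁻¹ * Real.exp (-(y ^ 2 + 1))))) ^ T :=
        ENNReal.rpow_le_rpow hball (by linarith)
    _ = ENNReal.ofReal (Real.exp (-(s⁻¹ * Real.exp (-(y ^ 2 + 1)) * T))) := by
        rw [ENNReal.ofReal_rpow_of_pos (Real.exp_pos _), ← Real.exp_mul, neg_mul]
    _ ≤ _ := by gcongr
end

section
/- For every real y ≠ 0, (|y|/π) · ∫_ℝ log⁺|s| / (s² + y²) ds ≤ log⁺|y| + 1, where log⁺ x = max(log x, 0). -/
open MeasureTheory Set Filter Topology in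
theorem integral_Ioi_one_log_div_sq : ∫ t in Ioi (1 : ℝ), Real.log t / t ^ 2 = 1 := by
  have hderiv : ∀ t ∈ Ici (1 : ℝ),
      HasDerivAt (fun t => -((Real.log t + 1) / t)) (Real.log t / t ^ 2) t := by
    intro t ht
    have ht0 : t ≠ 0 := (zero_lt_one.trans_le ht).ne'
    refine ((((Real.hasDerivAt_log ht0).add_const 1).div (hasDerivAt_id t) ht0).neg).congr_deriv ?_
    simp only [id]
    field_simp
    ring
  have hlim : Tendsto (fun t : ℝ => -((Real.log t + 1) / t)) atTop (𝓝 0) := by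
    have h₁ : Tendsto (fun t : ℝ => Real.log t / t) atTop (𝓝 0) :=
      Real.isLittleO_log_id_atTop.tendsto_div_nhds_zero
    simpa [add_div] using (h₁.add tendsto_inv_atTop_zero).neg
  rw [integral_Ioi_of_hasDerivAt_of_nonneg' hderiv
    (fun t ht => div_nonneg (Real.log_nonneg (le_of_lt ht)) (sq_nonneg t)) hlim]
  simp

open MeasureTheory Set in
theorem integral_indicator_log_div_sq_abs :
    ∫ t : ℝ, (Ioi (1 : ℝ)).indicator (fun t => Real.log t / t ^ 2) |t| = 2 := by
  rw [integral_comp_abs, setIntegral_indicator measurableSet_Ioi,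
    inter_eq_right.2 (Ioi_subset_Ioi zero_le_one), integral_Ioi_one_log_div_sq, mul_one]

open Real in
theorem sq_mul_posLog_mul_div_le {y : ℝ} (hy : y ≠ 0) (t : ℝ) :
    y ^ 2 * (log⁺ (y * t) / ((y * t) ^ 2 + y ^ 2)) ≤
      log⁺ y * (1 + t ^ 2)⁻¹ +
        (Set.Ioi (1 : ℝ)).indicator (fun t => log t / t ^ 2) |t| := by
  have hpos : 0 < 1 + t ^ 2 := by positivity
  have hlog : log⁺ t * (1 + t ^ 2)⁻¹ ≤
      (Set.Ioi (1 : ℝ)).indicator (fun t => log t / t ^ 2) |t| := by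
    by_cases ht : 1 < |t|
    · have ht0 : t ≠ 0 := abs_pos.1 (zero_lt_one.trans ht)
      rw [Set.indicator_of_mem (Set.mem_Ioi.2 ht), posLog_eq_log ht.le, log_abs, sq_abs,
        ← div_eq_mul_inv]
      have : 0 ≤ log t := by rw [← log_abs]; exact log_nonneg ht.le
      gcongr
      linarith
    · rw [Set.indicator_of_notMem (by simpa using ht),
        (posLog_eq_zero_iff t).2 (not_lt.1 ht), zero_mul]
  calc y ^ 2 * (log⁺ (y * t) / ((y * t) ^ 2 + y ^ 2))
      = log⁺ (y * t) * (1 + t ^ 2)⁻¹ := by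
        have : (y * t) ^ 2 + y ^ 2 = y ^ 2 * (1 + t ^ 2) := by ring
        rw [this]
        field_simp
    _ ≤ (log⁺ y + log⁺ t) * (1 + t ^ 2)⁻¹ := by
        gcongr
        exact posLog_mul
    _ ≤ _ := by rw [add_mul]; gcongr

open MeasureTheory Real in
theorem abs_mul_integral_posLog_div_le {y : ℝ} (hy : y ≠ 0) :
    |y| * ∫ s : ℝ, log⁺ s / (s ^ 2 + y ^ 2) ≤ log⁺ y * π + 2 := by
  have hint : Integrable
      (fun t : ℝ => (Set.Ioi (1 : ℝ)).indicator (fun t => log t / t ^ 2) |t|) :=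
    .of_integral_ne_zero (by rw [integral_indicator_log_div_sq_abs]; norm_num)
  have hsubst : |y| * ∫ s : ℝ, log⁺ s / (s ^ 2 + y ^ 2) =
      ∫ t : ℝ, y ^ 2 * (log⁺ (y * t) / ((y * t) ^ 2 + y ^ 2)) := by
    rw [integral_const_mul,
      Measure.integral_comp_mul_left (fun s => log⁺ s / (s ^ 2 + y ^ 2)) y, smul_eq_mul,
      ← mul_assoc, abs_inv, ← sq_abs]
    have := abs_ne_zero.2 hy
    field_simp
  rw [hsubst, ← integral_univ_inv_one_add_sq, ← integral_indicator_log_div_sq_abs,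
    ← integral_const_mul, ← integral_add (integrable_inv_one_add_sq.const_mul _) hint]
  refine integral_mono_of_nonneg (.of_forall fun t => ?_)
    ((integrable_inv_one_add_sq.const_mul _).add hint)
    (.of_forall (sq_mul_posLog_mul_div_le hy))
  have := posLog_nonneg (x := y * t)
  simp only [Pi.zero_apply]
  positivity

theorem logplus_poisson_bound (y : ℝ) (hy : y ≠ 0) :
    (|y| / Real.pi) * (∫ s : ℝ, max (Real.log |s|) 0 / (s ^ 2 + y ^ 2)) ≤
      max (Real.log |y|) 0 + 1 := by
  have h := abs_mul_integral_posLog_div_le hy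
  simp only [Real.posLog_apply, max_comm (0 : ℝ)] at h
  simp only [Real.log_abs]
  rw [div_mul_eq_mul_div, div_le_iff₀ Real.pi_pos]
  linarith [Real.pi_gt_three]
end

section
/- Let A > 0, T ≥ 0, and let F, G : ℝ → ℝ be continuous functions such that G(kπ/A) = (−1)^k · F(kπ/A) for every k ∈ ℤ, and F(kπ/A) ≠ 0 for every integer k with 0 ≤ kπ/A ≤ T. Then the extended-natural-number cardinality of {t ∈ [0,T] : F(t) = 0} plus the extended-natural-number cardinality of {t ∈ [0,T] : G(t) = 0} is at least ⌊A·T/π⌋. -/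
theorem natCast_le_encard_of_nonempty_inter_Ioo {a : ℕ → ℝ} (ha : Monotone a) (n : ℕ) (S : Set ℝ)
    (h : ∀ k < n, (S ∩ Set.Ioo (a k) (a (k + 1))).Nonempty) : (n : ℕ∞) ≤ S.encard := by
  choose t ht using fun k : Fin n => h k k.isLt
  have t_mono : StrictMono t := fun i j hij =>
    (ht i).2.2.trans_le ((ha (Nat.succ_le_of_lt hij)).trans (ht j).2.1.le)
  calc (n : ℕ∞) = (Set.range t).encard := by
        rw [← Set.image_univ, t_mono.injective.encard_image, Set.encard_univ]
        simp
    _ ≤ S.encard := Set.encard_le_encard (Set.range_subset_iff.2 fun k => (ht k).1)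

theorem exists_mem_Ioo_eq_zero_of_mul_neg {f : ℝ → ℝ} (hf : Continuous f) {a b : ℝ} (hab : a ≤ b)
    (h : f a * f b < 0) : ∃ t ∈ Set.Ioo a b, f t = 0 := by
  rcases mul_neg_iff.1 h with ⟨h₁, h₂⟩ | ⟨h₁, h₂⟩
  · exact intermediate_value_Ioo' hab hf.continuousOn ⟨h₂, h₁⟩
  · exact intermediate_value_Ioo hab hf.continuousOn ⟨h₁, h₂⟩

theorem zero_count_interlacing (A T : ℝ) (hA : 0 < A) (hT : 0 ≤ T)
    (F G : ℝ → ℝ) (hFc : Continuous F) (hGc : Continuous G)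
    (hG : ∀ k : ℤ, G (k * Real.pi / A) = (-1 : ℝ) ^ k * F (k * Real.pi / A))
    (hF : ∀ k : ℤ, 0 ≤ (k : ℝ) * Real.pi / A → (k : ℝ) * Real.pi / A ≤ T →
      F (k * Real.pi / A) ≠ 0) :
    (⌊A * T / Real.pi⌋₊ : ℕ∞) ≤
      {t ∈ Set.Icc (0:ℝ) T | F t = 0}.encard + {t ∈ Set.Icc (0:ℝ) T | G t = 0}.encard := by
  have hpi := Real.pi_pos
  set a : ℕ → ℝ := fun k => k * Real.pi / A with ha_def
  have ha : Monotone a := fun i j hij => by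
    simp only [ha_def]
    gcongr
  have ha_nonneg (k : ℕ) : 0 ≤ a k := by positivity
  have ha_le (k : ℕ) (hk : k ≤ ⌊A * T / Real.pi⌋₊) : a k ≤ T := by
    have h := (Nat.le_floor_iff (by positivity)).1 hk
    rw [le_div_iff₀ hpi] at h
    rw [ha_def, div_le_iff₀ hA]
    linarith
  have hFa (k : ℕ) (hk : k ≤ ⌊A * T / Real.pi⌋₊) : F (a k) ≠ 0 := by
    simpa using hF k (by simpa using ha_nonneg k) (by simpa using ha_le k hk)
  have hGa (k : ℕ) : G (a k) = (-1) ^ k * F (a k) := by simpa using hG k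
  refine (natCast_le_encard_of_nonempty_inter_Ioo ha _ _ fun k hk => ?_).trans
    (Set.encard_union_le _ _)
  have hIcc {t : ℝ} (ht : t ∈ Set.Ioo (a k) (a (k + 1))) : t ∈ Set.Icc 0 T :=
    ⟨(ha_nonneg k).trans ht.1.le, ht.2.le.trans (ha_le _ hk)⟩
  have hGG : G (a k) * G (a (k + 1)) = -(F (a k) * F (a (k + 1))) := by
    have hsq : ((-1 : ℝ) ^ k) * (-1) ^ k = 1 := by rw [← mul_pow]; simp
    rw [hGa, hGa, pow_succ]
    linear_combination -(F (a k) * F (a (k + 1))) * hsq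
  have hle : a k ≤ a (k + 1) := ha k.le_succ
  rcases lt_or_gt_of_ne (mul_ne_zero (hFa k hk.le) (hFa (k + 1) hk)) with h | h
  · obtain ⟨t, ht, h0⟩ := exists_mem_Ioo_eq_zero_of_mul_neg hFc hle h
    exact ⟨t, Or.inl ⟨hIcc ht, h0⟩, ht⟩
  · obtain ⟨t, ht, h0⟩ := exists_mem_Ioo_eq_zero_of_mul_neg hGc hle (by linarith)
    exact ⟨t, Or.inr ⟨hIcc ht, h0⟩, ht⟩
end
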